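/- One has ∫₀^{R₁} Φ(s)/φ(s) ds ≥ 2/m; consequently the constant c := min{1/β, 1/2}·(∫₀^{R₁} Φ(s)/φ(s) ds)^{−1} satisfies c ≤ m/4 (so that 2m − c > 0). -/

import Mathlib

open MeasureTheory intervalIntegral

/-- The Eberle weight `φ(r) = exp(−(β/4)∫₀^r max{0, a − m s} ds)`. -/
noncomputable def eberlePhi (β a m r : ℝ) : ℝ :=
  Real.exp (-(β / 4) * ∫ s in (0:ℝ)..r, max 0 (a - m * s))

/-- `Φ(r) = ∫₀^r φ(s) ds`. -/
noncomputable def eberleCapPhi (β a m r : ℝ) : ℝ :=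
  ∫ s in (0:ℝ)..r, eberlePhi β a m s

/-- `R₀ = a/m`. -/
noncomputable def eberleR0 (a m : ℝ) : ℝ := a / m

/-- `R₁ = a/m + 2/√m`. -/
noncomputable def eberleR1 (a m : ℝ) : ℝ := a / m + 2 / Real.sqrt m

/-- `∫₀^{R₁} Φ(s)/φ(s) ds`. -/
noncomputable def eberleIntRatio (β a m : ℝ) : ℝ :=
  ∫ s in (0:ℝ)..(eberleR1 a m), eberleCapPhi β a m s / eberlePhi β a m s

/-- `∫₀^{R₁} φ(s)⁻¹ ds`. -/
noncomputable def eberleIntInv (β a m : ℝ) : ℝ :=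
  ∫ s in (0:ℝ)..(eberleR1 a m), (eberlePhi β a m s)⁻¹

/-- The Eberle modulation function `g`. -/
noncomputable def eberleG (β a m r : ℝ) : ℝ :=
  1 - (1 / 4) * (∫ s in (0:ℝ)..(min r (eberleR1 a m)),
        eberleCapPhi β a m s / eberlePhi β a m s) / eberleIntRatio β a m
    - (1 / 4) * (∫ s in (0:ℝ)..(min r (eberleR1 a m)),
        (eberlePhi β a m s)⁻¹) / eberleIntInv β a m

/-- The Eberle concave distance function `f(r) = ∫₀^r φ(s) g(s) ds`. -/
noncomputable def eberleF (β a m r : ℝ) : ℝ :=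
  ∫ s in (0:ℝ)..r, eberlePhi β a m s * eberleG β a m s

/-- The contraction rate `c = min{1/β, 1/2} (∫₀^{R₁} Φ/φ)⁻¹`. -/
noncomputable def eberleC (β a m : ℝ) : ℝ :=
  min (1 / β) (1 / 2) * (eberleIntRatio β a m)⁻¹

/-- The drift lower bound `ε = min{Φ(R₁)(2∫₀^{R₁} Φ/φ)⁻¹, (β∫₀^{R₁} φ⁻¹)⁻¹}`. -/
noncomputable def eberleEps (β a m : ℝ) : ℝ :=
  min (eberleCapPhi β a m (eberleR1 a m) * (2 * eberleIntRatio β a m)⁻¹)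
    ((β * eberleIntInv β a m)⁻¹)

lemma continuous_max_zero_sub_mul (a m : ℝ) : Continuous fun s : ℝ => max 0 (a - m * s) := by
  fun_prop

lemma eberlePhi_pos (β a m r : ℝ) : 0 < eberlePhi β a m r := Real.exp_pos _

lemma continuous_eberlePhi (β a m : ℝ) : Continuous (eberlePhi β a m) :=
  Real.continuous_exp.comp <| continuous_const.mul <|
    intervalIntegral.continuous_primitive
      (fun _ _ => (continuous_max_zero_sub_mul a m).intervalIntegrable _ _) 0

lemma continuous_eberleCapPhi (β a m : ℝ) : Continuous (eberleCapPhi β a m) :=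
  intervalIntegral.continuous_primitive
    (fun _ _ => (continuous_eberlePhi β a m).intervalIntegrable _ _) 0

lemma antitone_eberlePhi {β : ℝ} (hβ : 0 ≤ β) (a m : ℝ) : Antitone (eberlePhi β a m) := by
  intro x y hxy
  have hInt : ∀ u v : ℝ, IntervalIntegrable (fun s => max 0 (a - m * s)) volume u v :=
    fun u v => (continuous_max_zero_sub_mul a m).intervalIntegrable u v
  have hsplit := intervalIntegral.integral_add_adjacent_intervals (hInt 0 x) (hInt x y)
  have hnonneg : 0 ≤ ∫ s in x..y, max 0 (a - m * s) :=
    intervalIntegral.integral_nonneg hxy fun _ _ => le_max_left _ _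
  refine Real.exp_le_exp.mpr (mul_le_mul_of_nonpos_left ?_ (by linarith))
  linarith

lemma mul_eberlePhi_le_eberleCapPhi {β r : ℝ} (hβ : 0 ≤ β) (a m : ℝ) (hr : 0 ≤ r) :
    r * eberlePhi β a m r ≤ eberleCapPhi β a m r := by
  have h := intervalIntegral.integral_mono_on hr
    (continuous_const (y := eberlePhi β a m r) |>.intervalIntegrable (μ := volume) 0 r)
    ((continuous_eberlePhi β a m).intervalIntegrable 0 r)
    fun s hs => antitone_eberlePhi hβ a m hs.2
  simpa [eberleCapPhi] using h

/-- Since `φ` is antitone, `Φ(s) / φ(s) ≥ s`, whence `∫₀^{R₁} Φ/φ ≥ R₁² / 2`. -/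
lemma sq_eberleR1_div_two_le_eberleIntRatio {β a m : ℝ} (hβ : 0 ≤ β) (hR : 0 ≤ eberleR1 a m) :
    eberleR1 a m ^ 2 / 2 ≤ eberleIntRatio β a m := by
  have hcont : Continuous fun s => eberleCapPhi β a m s / eberlePhi β a m s :=
    (continuous_eberleCapPhi β a m).div (continuous_eberlePhi β a m)
      fun s => (eberlePhi_pos β a m s).ne'
  have h := intervalIntegral.integral_mono_on hR
    (continuous_id.intervalIntegrable (μ := volume) 0 (eberleR1 a m))
    (hcont.intervalIntegrable 0 (eberleR1 a m))
    fun s hs => (le_div_iff₀ (eberlePhi_pos β a m s)).mpr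
      (mul_eberlePhi_le_eberleCapPhi hβ a m hs.1)
  simpa [eberleIntRatio] using h

/-- `∫₀^{R₁} Φ/φ ≥ 2/m`; consequently `c = min{1/β, 1/2}(∫₀^{R₁}Φ/φ)⁻¹ ≤ m/4`, so that
`2m − c > 0`. -/
theorem eberle_rate_dominated (m β a : ℝ) (hm : 0 < m) (hβ : 0 < β) (ha : 0 ≤ a) :
    2 / m ≤ eberleIntRatio β a m ∧
      eberleC β a m ≤ m / 4 ∧
      0 < 2 * m - eberleC β a m := by
  have hsqrt : 0 < 2 / Real.sqrt m := by positivity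
  have hR : 2 / Real.sqrt m ≤ eberleR1 a m := le_add_of_nonneg_left (by positivity)
  have hlower : 2 / m ≤ eberleIntRatio β a m :=
    calc 2 / m = (2 / Real.sqrt m) ^ 2 / 2 := by
          rw [div_pow, Real.sq_sqrt hm.le]
          ring
      _ ≤ eberleR1 a m ^ 2 / 2 := by gcongr
      _ ≤ eberleIntRatio β a m :=
          sq_eberleR1_div_two_le_eberleIntRatio hβ.le (hsqrt.le.trans hR)
  have hpos : 0 < eberleIntRatio β a m := lt_of_lt_of_le (by positivity) hlower
  have hC : eberleC β a m ≤ m / 4 :=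
    calc eberleC β a m ≤ 1 / 2 * (eberleIntRatio β a m)⁻¹ :=
          mul_le_mul_of_nonneg_right (min_le_right _ _) (inv_nonneg.mpr hpos.le)
      _ ≤ 1 / 2 * (2 / m)⁻¹ := by gcongr
      _ = m / 4 := by
          rw [inv_div]
          ring
  exact ⟨hlower, hC, by linarith⟩
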